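/- For every λ > 0 and every natural number n, the rescaled weighted counts of noncrossing weakly monotone labeled partitions converge to the n-th moment of ν_λ: lim_{m→∞} m^{−n/2} · b_{m,n}(λ√m) = ∫_ℝ x^n dν_λ(x). -/

import Mathlib

open MeasureTheory

-- `π` is a set partition of `{1, …, n}` (encoded on `Fin n`).
def IsSetPartition {n : ℕ} (π : Finset (Finset (Fin n))) : Prop :=
  (∀ B ∈ π, B.Nonempty) ∧ (∀ i : Fin n, ∃ B ∈ π, i ∈ B) ∧
    (∀ B ∈ π, ∀ B' ∈ π, B ≠ B' → Disjoint B B')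

-- `π` is noncrossing.
def NonCrossing {n : ℕ} (π : Finset (Finset (Fin n))) : Prop :=
  ∀ B ∈ π, ∀ B' ∈ π, B ≠ B' →
    ∀ v₁ ∈ B, ∀ v₂ ∈ B, ∀ w₁ ∈ B', ∀ w₂ ∈ B',
      ¬(v₁ < w₁ ∧ w₁ < v₂ ∧ v₂ < w₂)

-- `B'` is nested (non-strictly) inside `B`: `min B ≤ min B' ≤ max B' ≤ max B`.
def NestedLE {n : ℕ} (B B' : Finset (Fin n)) : Prop :=
  ∃ lo ∈ B, ∃ hi ∈ B, ∀ x ∈ B', lo ≤ x ∧ x ≤ hi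

-- `B'` is strictly nested inside `B`: `min B < min B'` and `max B' < max B`.
def NestedLT {n : ℕ} (B B' : Finset (Fin n)) : Prop :=
  ∃ lo ∈ B, ∃ hi ∈ B, ∀ x ∈ B', lo < x ∧ x < hi

-- the block `B` strictly encloses the point `w`.
def StrictEnc {n : ℕ} (B : Finset (Fin n)) (w : Fin n) : Prop :=
  ∃ v₁ ∈ B, ∃ v₂ ∈ B, v₁ < w ∧ w < v₂

-- the unlabeled part of `ANC^{wm}(m, n)`: a noncrossing partition of `{1, …, n}`
-- with all blocks of cardinality `1` or `2`, every singleton block being inner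
-- (strictly enclosed by some two-element block).
def IsANCPart {n : ℕ} (π : Finset (Finset (Fin n))) : Prop :=
  IsSetPartition π ∧ NonCrossing π ∧ (∀ B ∈ π, B.card ≤ 2) ∧
    (∀ B ∈ π, B.card = 1 → ∀ w ∈ B, ∃ B' ∈ π, B'.card = 2 ∧ StrictEnc B' w)

-- the label function `L : π → {1, …, m}` is weakly monotone for the nesting order,
-- and every singleton block carries the same label as the innermost two-element
-- block strictly enclosing it.
def WMLabel {n m : ℕ} (π : Finset (Finset (Fin n))) (L : {B // B ∈ π} → Fin m) : Prop :=
  (∀ B B' : {B // B ∈ π}, NestedLE B.val B'.val → L B ≤ L B') ∧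
    (∀ S : {B // B ∈ π}, S.val.card = 1 → ∀ w ∈ S.val,
      ∃ B' : {B // B ∈ π}, B'.val.card = 2 ∧ StrictEnc B'.val w ∧
        (∀ B'' : {B // B ∈ π}, B''.val.card = 2 → StrictEnc B''.val w →
          NestedLE B''.val B'.val) ∧
        L S = L B')

-- in addition, `L` is monotone: strictly increasing along strictly nested
-- two-element blocks.
def MLabel {n m : ℕ} (π : Finset (Finset (Fin n))) (L : {B // B ∈ π} → Fin m) : Prop :=
  WMLabel π L ∧
    ∀ B B' : {B // B ∈ π}, B.val.card = 2 → B'.val.card = 2 →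
      NestedLT B.val B'.val → L B < L B'

-- `bWM m n lam = b_{m,n}(λ) = Σ_{ε ∈ ANC^{wm}(m,n)} λ^{|ε|_0}`.
open Classical in
noncomputable def bWM (m n : ℕ) (lam : ℝ) : ℝ :=
  ∑ π : Finset (Finset (Fin n)),
    if IsANCPart π then
      ∑ L : {B // B ∈ π} → Fin m,
        if WMLabel π L then lam ^ (π.filter fun B => B.card = 1).card else 0
    else 0

-- `gM m n lam = g_{m,n}(λ) = Σ_{ε ∈ ANC^{m}(m,n)} λ^{|ε|_0}`.
open Classical in
noncomputable def gM (m n : ℕ) (lam : ℝ) : ℝ :=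
  ∑ π : Finset (Finset (Fin n)),
    if IsANCPart π then
      ∑ L : {B // B ∈ π} → Fin m,
        if MLabel π L then lam ^ (π.filter fun B => B.card = 1).card else 0
    else 0

-- Absolutely continuous part of `ν_λ`.
open Classical in
noncomputable def nuAC (lam : ℝ) : Measure ℝ :=
  volume.withDensity fun x =>
    ENNReal.ofReal (if x ∈ Set.Ioo (lam - Real.sqrt 2) (lam + Real.sqrt 2) then
      Real.sqrt (2 - (x - lam) ^ 2) / (Real.pi * (lam ^ 2 + 2 - (x - lam) ^ 2)) else 0)

-- `ν_λ = (λ/√(λ²+2))·δ_{λ−√(λ²+2)} + ν^{ac}_λ`.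
noncomputable def nuMeas (lam : ℝ) : Measure ℝ :=
  (ENNReal.ofReal (lam / Real.sqrt (lam ^ 2 + 2))) •
      Measure.dirac (lam - Real.sqrt (lam ^ 2 + 2)) + nuAC lam

section ArcConfigurations

/-- `E` encodes a weakly monotone labeled noncrossing partition of the interval `[a, b)` into blocks
`{x, y}` with label `l`, stored as `(x, y, l)` with `x ≤ y`, where labels lie in `[p, m)`. Outer
singletons are allowed only when `s = true`, and then they carry the label `p`. -/
structure ArcConfig (m a b p : ℕ) (s : Bool) (E : Finset (ℕ × ℕ × ℕ)) : Prop where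
  bounds : ∀ x y l, (x, y, l) ∈ E → a ≤ x ∧ x ≤ y ∧ y < b ∧ p ≤ l ∧ l < m
  cover : ∀ i, a ≤ i → i < b → ∃ x y l, (x, y, l) ∈ E ∧ (i = x ∨ i = y)
  unique : ∀ x y l x' y' l', (x, y, l) ∈ E → (x', y', l') ∈ E →
    (x = x' ∨ x = y' ∨ y = y') → x = x' ∧ y = y' ∧ l = l'
  noncrossing : ∀ x y l x' y' l', (x, y, l) ∈ E → (x', y', l') ∈ E →
    ¬(x < x' ∧ x' < y ∧ y < y')
  mono : ∀ x y l x' y' l', (x, y, l) ∈ E → (x', y', l') ∈ E → x ≤ x' → y' ≤ y → l ≤ l'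
  single : ∀ x l, (x, x, l) ∈ E →
    (s = true ∧ l = p) ∨ ∃ x' y', (x', y', l) ∈ E ∧ x' < x ∧ x < y'

/-- The arcs strictly between `a` and `k`. -/
def innerArcs (k : ℕ) (a : ℕ) (E : Finset (ℕ × ℕ × ℕ)) : Finset (ℕ × ℕ × ℕ) :=
  E.filter fun e => a < e.1 ∧ e.2.1 < k

/-- The arcs to the right of `k`. -/
def laterArcs (k : ℕ) (E : Finset (ℕ × ℕ × ℕ)) : Finset (ℕ × ℕ × ℕ) :=
  E.filter fun e => k < e.1

variable {m a b p k l : ℕ} {s : Bool} {E E₁ E₂ : Finset (ℕ × ℕ × ℕ)}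

lemma mem_innerArcs {x y z : ℕ} : (x, y, z) ∈ innerArcs k a E ↔ (x, y, z) ∈ E ∧ a < x ∧ y < k := by
  simp [innerArcs]

lemma mem_laterArcs {x y z : ℕ} : (x, y, z) ∈ laterArcs k E ↔ (x, y, z) ∈ E ∧ k < x := by
  simp [laterArcs]

namespace ArcConfig

lemma trichotomy (h : ArcConfig m a b p s E) (hk : (a, k, l) ∈ E) {x y z : ℕ}
    (hx : (x, y, z) ∈ E) : (x = a ∧ y = k ∧ z = l) ∨ (a < x ∧ x ≤ y ∧ y < k) ∨ (k < x ∧ x ≤ y) := by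
  have h1 := h.bounds _ _ _ hx
  have h2 := h.bounds _ _ _ hk
  have h3 := h.unique _ _ _ _ _ _ hk hx
  have h4 := h.unique _ _ _ _ _ _ hx hk
  have h5 := h.noncrossing _ _ _ _ _ _ hk hx
  grind

lemma inner (h : ArcConfig m a b p s E) (hk : (a, k, l) ∈ E) (hak : a < k) :
    ArcConfig m (a + 1) k l true (innerArcs k a E) where
  bounds x y z hx := by
    rw [mem_innerArcs] at hx
    have h1 := h.bounds _ _ _ hx.1
    have h2 := h.mono _ _ _ _ _ _ hk hx.1
    omega
  cover i hi hi' := by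
    obtain ⟨x, y, z, hx, hxi⟩ := h.cover i (by omega) (by have := h.bounds _ _ _ hk; omega)
    refine ⟨x, y, z, mem_innerArcs.2 ?_, hxi⟩
    have := h.trichotomy hk hx
    refine ⟨hx, ?_, ?_⟩ <;> omega
  unique x y z x' y' z' hx hx' :=
    h.unique _ _ _ _ _ _ (mem_innerArcs.1 hx).1 (mem_innerArcs.1 hx').1
  noncrossing x y z x' y' z' hx hx' :=
    h.noncrossing _ _ _ _ _ _ (mem_innerArcs.1 hx).1 (mem_innerArcs.1 hx').1
  mono x y z x' y' z' hx hx' :=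
    h.mono _ _ _ _ _ _ (mem_innerArcs.1 hx).1 (mem_innerArcs.1 hx').1
  single x z hx := by
    rw [mem_innerArcs] at hx
    have h1 := h.bounds _ _ _ hk
    have h2 := h.mono _ _ _ _ _ _ hk hx.1
    rcases h.single x z hx.1 with ⟨-, h3⟩ | ⟨x', y', h3, h4, h5⟩
    · left
      exact ⟨rfl, by omega⟩
    · have h6 := h.trichotomy hk h3
      by_cases hz : z = l
      · exact Or.inl ⟨rfl, hz⟩
      · refine Or.inr ⟨x', y', mem_innerArcs.2 ⟨h3, ?_, ?_⟩, h4, h5⟩ <;> omega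

lemma later (h : ArcConfig m a b p s E) (hk : (a, k, l) ∈ E) :
    ArcConfig m (k + 1) b p s (laterArcs k E) where
  bounds x y z hx := by
    rw [mem_laterArcs] at hx
    have h1 := h.bounds _ _ _ hx.1
    omega
  cover i hi hi' := by
    have h0 := h.bounds _ _ _ hk
    obtain ⟨x, y, z, hx, hxi⟩ := h.cover i (by omega) (by omega)
    refine ⟨x, y, z, mem_laterArcs.2 ?_, hxi⟩
    have := h.trichotomy hk hx
    refine ⟨hx, ?_⟩; omega
  unique x y z x' y' z' hx hx' :=
    h.unique _ _ _ _ _ _ (mem_laterArcs.1 hx).1 (mem_laterArcs.1 hx').1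
  noncrossing x y z x' y' z' hx hx' :=
    h.noncrossing _ _ _ _ _ _ (mem_laterArcs.1 hx).1 (mem_laterArcs.1 hx').1
  mono x y z x' y' z' hx hx' :=
    h.mono _ _ _ _ _ _ (mem_laterArcs.1 hx).1 (mem_laterArcs.1 hx').1
  single x z hx := by
    rw [mem_laterArcs] at hx
    rcases h.single x z hx.1 with h3 | ⟨x', y', h3, h4, h5⟩
    · exact Or.inl h3
    · have h6 := h.trichotomy hk h3
      refine Or.inr ⟨x', y', mem_laterArcs.2 ⟨h3, ?_⟩, h4, h5⟩; omega

lemma insert_inner_later (h : ArcConfig m a b p s E) (hk : (a, k, l) ∈ E) :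
    insert (a, k, l) (innerArcs k a E ∪ laterArcs k E) = E := by
  ext ⟨x, y, z⟩
  simp only [Finset.mem_insert, Finset.mem_union, mem_innerArcs, mem_laterArcs, Prod.mk.injEq]
  constructor
  · rintro (⟨rfl, rfl, rfl⟩ | h | h)
    exacts [hk, h.1, h.1]
  · intro hx
    have := h.trichotomy hk hx
    tauto

lemma empty : ArcConfig m a a p s ∅ := by
  constructor <;> simp

lemma eq_empty (h : ArcConfig m a a p s E) : E = ∅ := by
  rw [Finset.eq_empty_iff_forall_notMem]
  rintro ⟨x, y, z⟩ hx
  have := h.bounds _ _ _ hx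
  omega

lemma glue (h₁ : ArcConfig m (a + 1) k l true E₁) (h₂ : ArcConfig m (k + 1) b p s E₂)
    (hak : a < k) (hkb : k < b) (hpl : p ≤ l) (hlm : l < m) :
    ArcConfig m a b p s (insert (a, k, l) (E₁ ∪ E₂)) := by
  have key : ∀ x y z, (x, y, z) ∈ insert (a, k, l) (E₁ ∪ E₂) ↔
      (x = a ∧ y = k ∧ z = l) ∨ (x, y, z) ∈ E₁ ∨ (x, y, z) ∈ E₂ := by simp
  have b₁ := h₁.bounds
  have b₂ := h₂.bounds
  constructor
  · intro x y z hx
    rw [key] at hx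
    rcases hx with hx | hx | hx
    · omega
    · have := b₁ _ _ _ hx; omega
    · have := b₂ _ _ _ hx; omega
  · intro i hi hi'
    by_cases hia : i = a
    · exact ⟨a, k, l, by simp, Or.inl hia⟩
    by_cases hik : i = k
    · exact ⟨a, k, l, by simp, Or.inr hik⟩
    rcases lt_or_gt_of_ne hik with h | h
    · obtain ⟨x, y, z, hx, hxi⟩ := h₁.cover i (by omega) h
      exact ⟨x, y, z, (key _ _ _).2 (by tauto), hxi⟩
    · obtain ⟨x, y, z, hx, hxi⟩ := h₂.cover i (by omega) hi'
      exact ⟨x, y, z, (key _ _ _).2 (by tauto), hxi⟩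
  · intro x y z x' y' z' hx hx' hh
    rw [key] at hx hx'
    rcases hx with hx | hx | hx <;> rcases hx' with hx' | hx' | hx'
    · omega
    · have := b₁ _ _ _ hx'; omega
    · have := b₂ _ _ _ hx'; omega
    · have := b₁ _ _ _ hx; omega
    · exact h₁.unique _ _ _ _ _ _ hx hx' hh
    · have := b₁ _ _ _ hx; have := b₂ _ _ _ hx'; omega
    · have := b₂ _ _ _ hx; omega
    · have := b₂ _ _ _ hx; have := b₁ _ _ _ hx'; omega
    · exact h₂.unique _ _ _ _ _ _ hx hx' hh
  · intro x y z x' y' z' hx hx'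
    rw [key] at hx hx'
    rcases hx with hx | hx | hx <;> rcases hx' with hx' | hx' | hx'
    · omega
    · have := b₁ _ _ _ hx'; omega
    · have := b₂ _ _ _ hx'; omega
    · have := b₁ _ _ _ hx; omega
    · exact h₁.noncrossing _ _ _ _ _ _ hx hx'
    · have := b₁ _ _ _ hx; have := b₂ _ _ _ hx'; omega
    · have := b₂ _ _ _ hx; omega
    · have := b₂ _ _ _ hx; have := b₁ _ _ _ hx'; omega
    · exact h₂.noncrossing _ _ _ _ _ _ hx hx'
  · intro x y z x' y' z' hx hx' hh hh'
    rw [key] at hx hx'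
    rcases hx with hx | hx | hx <;> rcases hx' with hx' | hx' | hx'
    · omega
    · have := b₁ _ _ _ hx'; omega
    · have := b₂ _ _ _ hx'; omega
    · have := b₁ _ _ _ hx; omega
    · exact h₁.mono _ _ _ _ _ _ hx hx' hh hh'
    · have := b₁ _ _ _ hx; have := b₂ _ _ _ hx'; omega
    · have := b₂ _ _ _ hx; omega
    · have := b₂ _ _ _ hx; have := b₁ _ _ _ hx'; omega
    · exact h₂.mono _ _ _ _ _ _ hx hx' hh hh'
  · intro x z hx
    rw [key] at hx
    rcases hx with hx | hx | hx
    · omega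
    · have := b₁ _ _ _ hx
      rcases h₁.single _ _ hx with ⟨-, hz⟩ | ⟨x', y', h3, h4⟩
      · exact Or.inr ⟨a, k, (key _ _ _).2 (by simp [hz]), by omega, by omega⟩
      · exact Or.inr ⟨x', y', (key _ _ _).2 (by tauto), h4⟩
    · rcases h₂.single _ _ hx with hz | ⟨x', y', h3, h4⟩
      · exact Or.inl hz
      · exact Or.inr ⟨x', y', (key _ _ _).2 (by tauto), h4⟩

lemma insert_single (h₂ : ArcConfig m (a + 1) b p true E₂) (hab : a < b) (hpm : p < m) :
    ArcConfig m a b p true (insert (a, a, p) E₂) := by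
  have key : ∀ x y z, (x, y, z) ∈ insert (a, a, p) E₂ ↔
      (x = a ∧ y = a ∧ z = p) ∨ (x, y, z) ∈ E₂ := by simp
  have b₂ := h₂.bounds
  constructor
  · intro x y z hx
    rw [key] at hx
    rcases hx with hx | hx
    · omega
    · have := b₂ _ _ _ hx; omega
  · intro i hi hi'
    by_cases hia : i = a
    · exact ⟨a, a, p, by simp, Or.inl hia⟩
    · obtain ⟨x, y, z, hx, hxi⟩ := h₂.cover i (by omega) hi'
      exact ⟨x, y, z, (key _ _ _).2 (by tauto), hxi⟩
  · intro x y z x' y' z' hx hx' hh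
    rw [key] at hx hx'
    rcases hx with hx | hx <;> rcases hx' with hx' | hx'
    · omega
    · have := b₂ _ _ _ hx'; omega
    · have := b₂ _ _ _ hx; omega
    · exact h₂.unique _ _ _ _ _ _ hx hx' hh
  · intro x y z x' y' z' hx hx'
    rw [key] at hx hx'
    rcases hx with hx | hx <;> rcases hx' with hx' | hx'
    · omega
    · have := b₂ _ _ _ hx'; omega
    · have := b₂ _ _ _ hx; omega
    · exact h₂.noncrossing _ _ _ _ _ _ hx hx'
  · intro x y z x' y' z' hx hx' hh hh'
    rw [key] at hx hx'
    rcases hx with hx | hx <;> rcases hx' with hx' | hx'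
    · omega
    · have := b₂ _ _ _ hx'; omega
    · have := b₂ _ _ _ hx; omega
    · exact h₂.mono _ _ _ _ _ _ hx hx' hh hh'
  · intro x z hx
    rw [key] at hx
    rcases hx with hx | hx
    · exact Or.inl ⟨rfl, hx.2.2⟩
    · rcases h₂.single _ _ hx with hz | ⟨x', y', h3, h4⟩
      · exact Or.inl hz
      · exact Or.inr ⟨x', y', (key _ _ _).2 (by tauto), h4⟩

lemma of_single_mem (h : ArcConfig m a b p s E) (hk : (a, a, l) ∈ E) : s = true ∧ l = p := by
  rcases h.single _ _ hk with h1 | ⟨x', y', h3, h4⟩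
  · exact h1
  · have := h.bounds _ _ _ h3
    omega

end ArcConfig

/-- The weight `lam` to the number of singletons of `E`. -/
noncomputable def arcWeight (lam : ℝ) (E : Finset (ℕ × ℕ × ℕ)) : ℝ :=
  ∏ e ∈ E, if e.1 = e.2.1 then lam else 1

open Classical in
/-- The finite set of all `ArcConfig`s. -/
noncomputable def arcConfigs (m a b p : ℕ) (s : Bool) : Finset (Finset (ℕ × ℕ × ℕ)) :=
  (Finset.range b ×ˢ Finset.range b ×ˢ Finset.range m).powerset.filter (ArcConfig m a b p s)

lemma mem_arcConfigs : E ∈ arcConfigs m a b p s ↔ ArcConfig m a b p s E := by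
  simp only [arcConfigs, Finset.mem_filter, Finset.mem_powerset, and_iff_right_iff_imp]
  rintro h ⟨x, y, z⟩ hx
  have := h.bounds _ _ _ hx
  simp
  omega

/-- The total weight of the arc configurations on `n` points with `j` available labels, given by the
recursion on the block containing the first point. -/
noncomputable def arcCount (lam : ℝ) : Bool → ℕ → ℕ → ℝ
  | _, 0, _ => 1
  | s, n + 1, j => (if s then lam * arcCount lam s n j else 0) +
      ∑ k : Fin n, (∑ i ∈ Finset.Icc 1 j, arcCount lam true k i) * arcCount lam s (n - 1 - k) j
termination_by _ n _ => n
decreasing_by all_goals omega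

lemma sum_pair (lam : ℝ) (hak : a < k) (hkb : k < b) (hpl : p ≤ l) (hlm : l < m) :
    ∑ E ∈ arcConfigs m a b p s with (a, k, l) ∈ E, arcWeight lam E =
      (∑ E ∈ arcConfigs m (a + 1) k l true, arcWeight lam E) *
        ∑ E ∈ arcConfigs m (k + 1) b p s, arcWeight lam E := by
  rw [Finset.sum_mul_sum, ← Finset.sum_product']
  have aux : ∀ E₁ E₂, ArcConfig m (a + 1) k l true E₁ → ArcConfig m (k + 1) b p s E₂ →
      innerArcs k a (insert (a, k, l) (E₁ ∪ E₂)) = E₁ ∧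
      laterArcs k (insert (a, k, l) (E₁ ∪ E₂)) = E₂ ∧
      arcWeight lam (insert (a, k, l) (E₁ ∪ E₂)) = arcWeight lam E₁ * arcWeight lam E₂ := by
    intro E₁ E₂ h₁ h₂
    have b₁ := h₁.bounds
    have b₂ := h₂.bounds
    refine ⟨?_, ?_, ?_⟩
    · ext ⟨x, y, z⟩
      simp only [mem_innerArcs, Finset.mem_insert, Finset.mem_union, Prod.mk.injEq]
      have := b₁ x y z
      have := b₂ x y z
      grind
    · ext ⟨x, y, z⟩
      simp only [mem_laterArcs, Finset.mem_insert, Finset.mem_union, Prod.mk.injEq]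
      have := b₁ x y z
      have := b₂ x y z
      grind
    · rw [arcWeight, Finset.prod_insert, Finset.prod_union]
      · simp [arcWeight, hak.ne]
      · rw [Finset.disjoint_left]
        rintro ⟨x, y, z⟩ h h'
        have := b₁ _ _ _ h
        have := b₂ _ _ _ h'
        omega
      · intro h
        rcases Finset.mem_union.1 h with h | h
        · have := b₁ _ _ _ h
          omega
        · have := b₂ _ _ _ h
          omega
  refine Finset.sum_nbij' (fun E => (innerArcs k a E, laterArcs k E))
    (fun P => insert (a, k, l) (P.1 ∪ P.2)) ?_ ?_ ?_ ?_ ?_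
  · intro E hE
    simp only [Finset.mem_filter, mem_arcConfigs] at hE
    simp only [Finset.mem_product, mem_arcConfigs]
    exact ⟨hE.1.inner hE.2 hak, hE.1.later hE.2⟩
  · rintro ⟨E₁, E₂⟩ hE
    simp only [Finset.mem_product, mem_arcConfigs] at hE
    simp only [Finset.mem_filter, mem_arcConfigs]
    exact ⟨hE.1.glue hE.2 hak hkb hpl hlm, by simp⟩
  · intro E hE
    simp only [Finset.mem_filter, mem_arcConfigs] at hE
    exact hE.1.insert_inner_later hE.2
  · rintro ⟨E₁, E₂⟩ hE
    simp only [Finset.mem_product, mem_arcConfigs] at hE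
    simp [(aux _ _ hE.1 hE.2).1, (aux _ _ hE.1 hE.2).2.1]
  · intro E hE
    simp only [Finset.mem_filter, mem_arcConfigs] at hE
    conv_lhs => rw [← hE.1.insert_inner_later hE.2]
    exact (aux _ _ (hE.1.inner hE.2 hak) (hE.1.later hE.2)).2.2

lemma sum_single (lam : ℝ) (hab : a < b) (hpm : p < m) :
    ∑ E ∈ arcConfigs m a b p true with (a, a, p) ∈ E, arcWeight lam E =
      lam * ∑ E ∈ arcConfigs m (a + 1) b p true, arcWeight lam E := by
  rw [Finset.mul_sum]
  have aux : ∀ E, ArcConfig m (a + 1) b p true E → (a, a, p) ∉ E ∧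
      laterArcs a (insert (a, a, p) E) = E := by
    intro E h
    refine ⟨fun h' => ?_, ?_⟩
    · have := h.bounds _ _ _ h'; omega
    · ext ⟨x, y, z⟩
      simp only [mem_laterArcs, Finset.mem_insert, Prod.mk.injEq]
      have := h.bounds x y z
      grind
  have aux' : ∀ E, ArcConfig m a b p true E → (a, a, p) ∈ E →
      insert (a, a, p) (laterArcs a E) = E := by
    intro E h h'
    conv_rhs => rw [← h.insert_inner_later h']
    congr 1
    have h0 : innerArcs a a E = ∅ := by
      rw [Finset.eq_empty_iff_forall_notMem]
      rintro ⟨x, y, z⟩ hx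
      rw [mem_innerArcs] at hx
      have := h.bounds _ _ _ hx.1
      omega
    rw [h0, Finset.empty_union]
  refine Finset.sum_nbij' (fun E => laterArcs a E)
    (fun E => insert (a, a, p) E) ?_ ?_ ?_ ?_ ?_
  · intro E hE
    simp only [Finset.mem_filter, mem_arcConfigs] at hE ⊢
    exact hE.1.later hE.2
  · intro E hE
    simp only [Finset.mem_filter, mem_arcConfigs] at hE ⊢
    exact ⟨hE.insert_single hab hpm, by simp⟩
  · intro E hE
    simp only [Finset.mem_filter, mem_arcConfigs] at hE
    exact aux' _ hE.1 hE.2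
  · intro E hE
    simp only [mem_arcConfigs] at hE
    exact (aux _ hE).2
  · intro E hE
    simp only [Finset.mem_filter, mem_arcConfigs] at hE
    conv_lhs => rw [← aux' _ hE.1 hE.2]
    rw [arcWeight, Finset.prod_insert (aux _ (hE.1.later hE.2)).1]
    simp [arcWeight]

lemma sum_arcConfigs_first (lam : ℝ) (hab : a < b) :
    ∑ E ∈ arcConfigs m a b p s, arcWeight lam E =
      ∑ k ∈ Finset.Ico a b, ∑ l ∈ Finset.range m,
        ∑ E ∈ arcConfigs m a b p s with (a, k, l) ∈ E, arcWeight lam E := by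
  rw [← Finset.sum_product']
  simp_rw [Finset.sum_filter]
  rw [Finset.sum_comm]
  refine Finset.sum_congr rfl fun E hE => ?_
  rw [mem_arcConfigs] at hE
  obtain ⟨x, y, z, hx, hxi⟩ := hE.cover a le_rfl hab
  have hb := hE.bounds _ _ _ hx
  obtain rfl : x = a := by omega
  rw [Finset.sum_eq_single_of_mem (y, z)]
  · simp [hx]
  · simp; omega
  · rintro ⟨y', z'⟩ - hne
    rw [if_neg]
    intro h'
    have := hE.unique _ _ _ _ _ _ hx h' (Or.inl rfl)
    exact hne (by simp [this.2.1, this.2.2])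

theorem sum_arcConfigs (lam : ℝ) (n : ℕ) : ∀ (a p : ℕ) (s : Bool), p < m →
    ∑ E ∈ arcConfigs m a (a + n) p s, arcWeight lam E = arcCount lam s n (m - p) := by
  induction n using Nat.strong_induction_on with
  | _ n ih =>
    intro a p s hpm
    rcases n with _ | n
    · have : arcConfigs m a (a + 0) p s = {∅} := by
        ext E
        rw [mem_arcConfigs, Finset.mem_singleton]
        exact ⟨fun h => h.eq_empty, fun h => h ▸ ArcConfig.empty⟩
      rw [this, Finset.sum_singleton, arcCount, arcWeight, Finset.prod_empty]
    · rw [sum_arcConfigs_first lam (by omega), Finset.sum_eq_sum_Ico_succ_bot (by omega), arcCount]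
      congr 1
      · have h0 : ∀ l, ¬ (s = true ∧ l = p) →
            ∑ E ∈ arcConfigs m a (a + (n + 1)) p s with (a, a, l) ∈ E, arcWeight lam E = 0 := by
          intro l hl
          rw [Finset.filter_false_of_mem, Finset.sum_empty]
          intro E hE h
          exact hl ((mem_arcConfigs.1 hE).of_single_mem h)
        split_ifs with hs
        · subst hs
          rw [Finset.sum_eq_single_of_mem p (by simpa using hpm)
            (fun l _ hl => h0 l (by simp [hl])), sum_single lam (by omega) hpm,
            ← ih n (by omega) (a + 1) p true hpm, show a + (n + 1) = a + 1 + n by omega]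
        · exact Finset.sum_eq_zero fun l _ => h0 l (by simp [hs])
      · rw [Finset.sum_Ico_eq_sum_range, Finset.sum_range,
          show a + (n + 1) - (a + 1) = n by omega]
        refine Finset.sum_congr rfl fun k _ => ?_
        have hk := k.2
        rw [Finset.sum_mul]
        have h1 : ∀ l ∈ Finset.range m,
            ∑ E ∈ arcConfigs m a (a + (n + 1)) p s with (a, a + 1 + k, l) ∈ E, arcWeight lam E =
            if p ≤ l then arcCount lam true k (m - l) * arcCount lam s (n - 1 - k) (m - p)
            else 0 := by
          intro l hl
          split_ifs with hpl
          · rw [sum_pair lam (by omega) (by omega) hpl (by simpa using hl),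
              ih k (by omega) _ _ _ (by simpa using hl),
              ← ih (n - 1 - k) (by omega) (a + 1 + k + 1) p s hpm,
              show a + 1 + k + 1 + (n - 1 - k) = a + (n + 1) by omega]
          · rw [Finset.filter_false_of_mem, Finset.sum_empty]
            intro E hE h
            have := (mem_arcConfigs.1 hE).bounds _ _ _ h
            omega
        rw [Finset.sum_congr rfl h1, ← Finset.sum_filter]
        refine Finset.sum_nbij' (fun l => m - l) (fun i => m - i) ?_ ?_ ?_ ?_ ?_
        · intro l hl
          simp at hl ⊢; omega
        · intro l hl
          simp at hl ⊢; omega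
        · intro l hl
          simp at hl ⊢; omega
        · intro l hl
          simp at hl ⊢; omega
        · intro l hl
          rfl

section Translation

variable {n : ℕ}

open Classical in
/-- The arcs `(min B, max B, L B)` of a labeled partition into blocks of size at most two. -/
noncomputable def arcsOf (π : Finset (Finset (Fin n))) (L : {B // B ∈ π} → Fin m) :
    Finset (ℕ × ℕ × ℕ) :=
  (Finset.range n ×ˢ Finset.range n ×ˢ Finset.range m).filter fun e =>
    ∃ (x y : Fin n) (h : {x, y} ∈ π), x ≤ y ∧ e = (x.val, y.val, (L ⟨{x, y}, h⟩).val)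

lemma mem_arcsOf {π : Finset (Finset (Fin n))} {L : {B // B ∈ π} → Fin m} {e : ℕ × ℕ × ℕ} :
    e ∈ arcsOf π L ↔
      ∃ (x y : Fin n) (h : {x, y} ∈ π), x ≤ y ∧ e = (x.val, y.val, (L ⟨{x, y}, h⟩).val) := by
  simp only [arcsOf, Finset.mem_filter, and_iff_right_iff_imp]
  rintro ⟨x, y, h, hxy, rfl⟩
  simp

lemma pair_eq_pair_of_le {x y x' y' : Fin n} (h : x ≤ y) (h' : x' ≤ y')
    (he : ({x, y} : Finset (Fin n)) = {x', y'}) : x = x' ∧ y = y' := by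
  have h1 : x ∈ ({x', y'} : Finset (Fin n)) := he ▸ by simp
  have h2 : y ∈ ({x', y'} : Finset (Fin n)) := he ▸ by simp
  have h3 : x' ∈ ({x, y} : Finset (Fin n)) := he ▸ by simp
  have h4 : y' ∈ ({x, y} : Finset (Fin n)) := he ▸ by simp
  simp only [Finset.mem_insert, Finset.mem_singleton] at h1 h2 h3 h4
  omega

lemma exists_pair_of_card_le_two {B : Finset (Fin n)} (h : B.Nonempty) (hB : B.card ≤ 2) :
    ∃ x y, x ≤ y ∧ B = {x, y} := by
  have := h.card_pos
  obtain h1 | h2 : B.card = 1 ∨ B.card = 2 := by omega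
  · obtain ⟨x, rfl⟩ := Finset.card_eq_one.1 h1
    exact ⟨x, x, le_rfl, by simp⟩
  · obtain ⟨x, y, hxy, rfl⟩ := Finset.card_eq_two.1 h2
    rcases le_total x y with h | h
    · exact ⟨x, y, h, rfl⟩
    · exact ⟨y, x, h, Finset.pair_comm _ _⟩

lemma nestedLE_pair {x y x' y' : Fin n} (h : x ≤ y) (h' : x' ≤ y') :
    NestedLE {x, y} {x', y'} ↔ x ≤ x' ∧ y' ≤ y := by
  simp only [NestedLE, Finset.mem_insert, Finset.mem_singleton]
  constructor
  · rintro ⟨lo, hlo, hi, hhi, H⟩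
    have := H x' (by simp)
    have := H y' (by simp)
    omega
  · rintro ⟨h1, h2⟩
    exact ⟨x, by simp, y, by simp, by rintro z (rfl | rfl) <;> omega⟩

lemma strictEnc_pair {x y w : Fin n} (h : x ≤ y) : StrictEnc {x, y} w ↔ x < w ∧ w < y := by
  simp only [StrictEnc, Finset.mem_insert, Finset.mem_singleton]
  constructor
  · rintro ⟨v, hv, v', hv', H⟩
    omega
  · rintro ⟨h1, h2⟩
    exact ⟨x, by simp, y, by simp, h1, h2⟩

lemma card_pair_eq_one {x y : Fin n} : ({x, y} : Finset (Fin n)).card = 1 ↔ x = y := by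
  by_cases h : x = y
  · simp [h]
  · simp [h, Finset.card_pair h]

lemma card_pair_eq_two {x y : Fin n} : ({x, y} : Finset (Fin n)).card = 2 ↔ x ≠ y := by
  by_cases h : x = y
  · simp [h]
  · simp [h, Finset.card_pair h]

variable {π : Finset (Finset (Fin n))} {L : {B // B ∈ π} → Fin m}

lemma IsANCPart.exists_pair (h : IsANCPart π) {B : Finset (Fin n)} (hB : B ∈ π) :
    ∃ x y, x ≤ y ∧ B = {x, y} :=
  exists_pair_of_card_le_two (h.1.1 B hB) (h.2.2.1 B hB)

lemma IsANCPart.eq_of_mem (h : IsANCPart π) {B B' : Finset (Fin n)} (hB : B ∈ π) (hB' : B' ∈ π)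
    {x : Fin n} (hx : x ∈ B) (hx' : x ∈ B') : B = B' := by
  by_contra hne
  exact Finset.disjoint_left.1 (h.1.2.2 B hB B' hB' hne) hx hx'

lemma arcConfig_arcsOf (h : IsANCPart π) (hL : WMLabel π L) :
    ArcConfig m 0 n 0 false (arcsOf π L) where
  bounds x y l hx := by
    obtain ⟨x, y, hxy, hle, he⟩ := mem_arcsOf.1 hx
    simp only [Prod.mk.injEq] at he
    omega
  cover i _ hi := by
    obtain ⟨B, hB, hi⟩ := h.1.2.1 ⟨i, hi⟩
    obtain ⟨x, y, hxy, rfl⟩ := h.exists_pair hB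
    refine ⟨x, y, L ⟨_, hB⟩, mem_arcsOf.2 ⟨x, y, hB, hxy, rfl⟩, ?_⟩
    simpa [Fin.ext_iff] using hi
  unique x y l x' y' l' hx hx' hh := by
    obtain ⟨x, y, hxy, hle, he⟩ := mem_arcsOf.1 hx
    obtain ⟨x', y', hxy', hle', he'⟩ := mem_arcsOf.1 hx'
    simp only [Prod.mk.injEq] at he he'
    obtain ⟨rfl, rfl, rfl⟩ := he
    obtain ⟨rfl, rfl, rfl⟩ := he'
    simp only [← Fin.ext_iff] at hh
    have : ({x, y} : Finset (Fin n)) = {x', y'} := by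
      rcases hh with hh | hh | hh
      · exact h.eq_of_mem hxy hxy' (x := x) (by simp) (by simp [hh])
      · exact h.eq_of_mem hxy hxy' (x := x) (by simp) (by simp [hh])
      · exact h.eq_of_mem hxy hxy' (x := y) (by simp) (by simp [hh])
    obtain ⟨rfl, rfl⟩ := pair_eq_pair_of_le hle hle' this
    simp
  noncrossing x y l x' y' l' hx hx' := by
    obtain ⟨x, y, hxy, hle, he⟩ := mem_arcsOf.1 hx
    obtain ⟨x', y', hxy', hle', he'⟩ := mem_arcsOf.1 hx'
    simp only [Prod.mk.injEq] at he he'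
    obtain ⟨rfl, rfl, rfl⟩ := he
    obtain ⟨rfl, rfl, rfl⟩ := he'
    intro hc
    refine h.2.1 _ hxy _ hxy' ?_ x (by simp) y (by simp) x' (by simp) y' (by simp) hc
    intro h2
    obtain ⟨rfl, rfl⟩ := pair_eq_pair_of_le hle hle' h2
    omega
  mono x y l x' y' l' hx hx' h1 h2 := by
    obtain ⟨x, y, hxy, hle, he⟩ := mem_arcsOf.1 hx
    obtain ⟨x', y', hxy', hle', he'⟩ := mem_arcsOf.1 hx'
    simp only [Prod.mk.injEq] at he he'
    obtain ⟨rfl, rfl, rfl⟩ := he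
    obtain ⟨rfl, rfl, rfl⟩ := he'
    exact hL.1 ⟨_, hxy⟩ ⟨_, hxy'⟩ ((nestedLE_pair hle hle').2 ⟨h1, h2⟩)
  single x l hx := by
    obtain ⟨x, y, hxy, hle, he⟩ := mem_arcsOf.1 hx
    simp only [Prod.mk.injEq] at he
    obtain ⟨rfl, h0, rfl⟩ := he
    obtain rfl : x = y := Fin.ext h0
    right
    obtain ⟨⟨B, hB⟩, -, h2, -, h3⟩ := hL.2 ⟨_, hxy⟩ (by simp) x (by simp)
    obtain ⟨x', y', hxy', rfl⟩ := h.exists_pair hB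
    refine ⟨x', y', mem_arcsOf.2 ⟨x', y', hB, hxy', by rw [h3]⟩, ?_⟩
    exact (strictEnc_pair hxy').1 h2

lemma arcWeight_arcsOf (lam : ℝ) (h : IsANCPart π) :
    arcWeight lam (arcsOf π L) = lam ^ (π.filter fun B => B.card = 1).card := by
  rw [arcWeight, ← Finset.prod_filter, Finset.prod_const]
  congr 1
  symm
  refine Finset.card_bij (fun B hB =>
    ((B.min' (h.1.1 B (Finset.mem_filter.1 hB).1)).val,
      (B.min' (h.1.1 B (Finset.mem_filter.1 hB).1)).val,
      (L ⟨B, (Finset.mem_filter.1 hB).1⟩).val)) ?_ ?_ ?_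
  · intro B hB
    rw [Finset.mem_filter] at hB
    obtain ⟨x, rfl⟩ := Finset.card_eq_one.1 hB.2
    simp only [Finset.mem_filter, Finset.min'_singleton, and_true]
    refine mem_arcsOf.2 ⟨x, x, by simpa using hB.1, le_rfl, ?_⟩
    simp
  · intro B hB B' hB' he
    rw [Finset.mem_filter] at hB hB'
    obtain ⟨x, rfl⟩ := Finset.card_eq_one.1 hB.2
    obtain ⟨y, rfl⟩ := Finset.card_eq_one.1 hB'.2
    simp only [Finset.min'_singleton, Prod.mk.injEq, ← Fin.ext_iff] at he
    rw [he.1]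
  · intro e he
    rw [Finset.mem_filter] at he
    obtain ⟨x, y, hxy, hle, rfl⟩ := mem_arcsOf.1 he.1
    obtain rfl : x = y := Fin.ext he.2
    exact ⟨{x}, by simpa using hxy, by simp⟩

lemma subset_of_arcsOf_eq {π' : Finset (Finset (Fin n))} {L' : {B // B ∈ π'} → Fin m}
    (h : IsANCPart π) (he : arcsOf π L = arcsOf π' L') {B : Finset (Fin n)} (hB : B ∈ π) :
    ∃ hB' : B ∈ π', L ⟨B, hB⟩ = L' ⟨B, hB'⟩ := by
  obtain ⟨x, y, hxy, rfl⟩ := h.exists_pair hB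
  have h1 := (mem_arcsOf (L := L)).2 ⟨x, y, hB, hxy, rfl⟩
  rw [he] at h1
  obtain ⟨x', y', hxy', hle', he'⟩ := mem_arcsOf.1 h1
  simp only [Prod.mk.injEq, ← Fin.ext_iff] at he'
  obtain ⟨rfl, rfl, h3⟩ := he'
  exact ⟨hxy', h3⟩

open Classical in
/-- The blocks `{x, y}` of an arc configuration. -/
noncomputable def blocksOf (n : ℕ) (E : Finset (ℕ × ℕ × ℕ)) : Finset (Finset (Fin n)) :=
  Finset.univ.filter fun B => ∃ (x y : Fin n) (l : ℕ), x ≤ y ∧ (x.val, y.val, l) ∈ E ∧ B = {x, y}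

lemma mem_blocksOf {B : Finset (Fin n)} : B ∈ blocksOf n E ↔
    ∃ (x y : Fin n) (l : ℕ), x ≤ y ∧ (x.val, y.val, l) ∈ E ∧ B = {x, y} := by
  simp [blocksOf]

/-- The labels carried by the blocks of an arc configuration. -/
noncomputable def blockLabel (h : ArcConfig m 0 n 0 false E) (B : {B // B ∈ blocksOf n E}) :
    Fin m :=
  ⟨(mem_blocksOf.1 B.2).choose_spec.choose_spec.choose, by
    have := (mem_blocksOf.1 B.2).choose_spec.choose_spec.choose_spec.2.1
    exact (h.bounds _ _ _ this).2.2.2.2⟩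

lemma mem_of_blockLabel (h : ArcConfig m 0 n 0 false E) {x y : Fin n} (hxy : x ≤ y)
    (hB : {x, y} ∈ blocksOf n E) : (x.val, y.val, (blockLabel h ⟨_, hB⟩).val) ∈ E := by
  have h1 := (mem_blocksOf.1 hB).choose_spec.choose_spec.choose_spec
  have h2 := pair_eq_pair_of_le hxy h1.1 h1.2.2
  have h3 : (x.val, y.val, (blockLabel h ⟨_, hB⟩).val) = (_, _, (blockLabel h ⟨_, hB⟩).val) :=
    Prod.ext (congrArg Fin.val h2.1) (Prod.ext (congrArg Fin.val h2.2) rfl)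
  rw [h3]
  exact h1.2.1

lemma arcsOf_blockLabel (h : ArcConfig m 0 n 0 false E) :
    arcsOf (blocksOf n E) (blockLabel h) = E := by
  ext ⟨x, y, l⟩
  rw [mem_arcsOf]
  constructor
  · rintro ⟨x, y, hB, hxy, he⟩
    rw [he]
    exact mem_of_blockLabel h hxy hB
  · intro hx
    have hb := h.bounds _ _ _ hx
    have hB : ({⟨x, by omega⟩, ⟨y, by omega⟩} : Finset (Fin n)) ∈ blocksOf n E :=
      mem_blocksOf.2 ⟨_, _, l, by simpa using hb.2.1, hx, rfl⟩
    refine ⟨⟨x, by omega⟩, ⟨y, by omega⟩, hB, by simpa using hb.2.1, ?_⟩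
    have h3 := mem_of_blockLabel h (by simpa using hb.2.1) hB
    have := h.unique _ _ _ _ _ _ hx h3 (Or.inl rfl)
    simp [← this.2.2]

lemma isANCPart_blocksOf (h : ArcConfig m 0 n 0 false E) : IsANCPart (blocksOf n E) := by
  refine ⟨⟨?_, ?_, ?_⟩, ?_, ?_, ?_⟩
  · intro B hB
    obtain ⟨x, y, l, hxy, hE, rfl⟩ := mem_blocksOf.1 hB
    simp
  · intro i
    obtain ⟨x, y, l, hE, hi⟩ := h.cover i (by omega) i.2
    have hb := h.bounds _ _ _ hE
    have hle : (⟨x, by omega⟩ : Fin n) ≤ ⟨y, by omega⟩ := by simpa using hb.2.1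
    refine ⟨{⟨x, by omega⟩, ⟨y, by omega⟩}, mem_blocksOf.2 ⟨_, _, l, hle, hE, rfl⟩, ?_⟩
    simpa [Fin.ext_iff] using hi
  · intro B hB B' hB' hne
    obtain ⟨x, y, l, hxy, hE, rfl⟩ := mem_blocksOf.1 hB
    obtain ⟨x', y', l', hxy', hE', rfl⟩ := mem_blocksOf.1 hB'
    rw [Finset.disjoint_left]
    intro i hi hi'
    simp only [Finset.mem_insert, Finset.mem_singleton] at hi hi'
    have h1 := h.unique _ _ _ _ _ _ hE hE'
    have h2 := h.unique _ _ _ _ _ _ hE' hE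
    simp only [← Fin.ext_iff] at h1 h2
    have : x = x' ∧ y = y' := by grind
    exact hne (by rw [this.1, this.2])
  · intro B hB B' hB' hne v₁ hv₁ v₂ hv₂ w₁ hw₁ w₂ hw₂
    obtain ⟨x, y, l, hxy, hE, rfl⟩ := mem_blocksOf.1 hB
    obtain ⟨x', y', l', hxy', hE', rfl⟩ := mem_blocksOf.1 hB'
    simp only [Finset.mem_insert, Finset.mem_singleton] at hv₁ hv₂ hw₁ hw₂
    have h1 := h.noncrossing _ _ _ _ _ _ hE hE'
    omega
  · intro B hB
    obtain ⟨x, y, l, hxy, hE, rfl⟩ := mem_blocksOf.1 hB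
    exact Finset.card_le_two
  · intro B hB hc w hw
    obtain ⟨x, y, l, hxy, hE, rfl⟩ := mem_blocksOf.1 hB
    obtain rfl := card_pair_eq_one.1 hc
    obtain rfl : w = x := by simpa using hw
    rcases h.single _ _ hE with h1 | ⟨x', y', hE', h1, h2⟩
    · simp at h1
    · have hb := h.bounds _ _ _ hE'
      have hle : (⟨x', by omega⟩ : Fin n) ≤ ⟨y', by omega⟩ := by simpa using hb.2.1
      refine ⟨{⟨x', by omega⟩, ⟨y', by omega⟩}, mem_blocksOf.2 ⟨_, _, l, hle, hE', rfl⟩, ?_, ?_⟩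
      · rw [card_pair_eq_two]
        simp; omega
      · rw [strictEnc_pair hle]
        exact ⟨h1, h2⟩

lemma wmLabel_blockLabel (h : ArcConfig m 0 n 0 false E) :
    WMLabel (blocksOf n E) (blockLabel h) := by
  have hA := isANCPart_blocksOf h
  have hmono : ∀ B B' : {B // B ∈ blocksOf n E}, NestedLE B.val B'.val →
      blockLabel h B ≤ blockLabel h B' := by
    rintro ⟨B, hB⟩ ⟨B', hB'⟩ hn
    obtain ⟨x, y, hxy, rfl⟩ := hA.exists_pair hB
    obtain ⟨x', y', hxy', rfl⟩ := hA.exists_pair hB'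
    have := (nestedLE_pair hxy hxy').1 hn
    exact h.mono _ _ _ _ _ _ (mem_of_blockLabel h hxy hB) (mem_of_blockLabel h hxy' hB')
      this.1 this.2
  refine ⟨hmono, ?_⟩
  rintro ⟨B, hB⟩ hc w hw
  obtain ⟨x, y, hxy, rfl⟩ := hA.exists_pair hB
  obtain rfl := card_pair_eq_one.1 hc
  obtain rfl : w = x := by simpa using hw
  have hE := mem_of_blockLabel h hxy hB
  rcases h.single _ _ hE with h1 | ⟨x', y', hE', h1, h2⟩
  · simp at h1
  -- the enclosing arc with the largest left end is the innermost one
  let S : Finset (ℕ × ℕ × ℕ) := E.filter fun e => e.1 < w.val ∧ w.val < e.2.1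
  have hS : S.Nonempty := ⟨_, Finset.mem_filter.2 ⟨hE', h1, h2⟩⟩
  obtain ⟨⟨x₀, y₀, l₀⟩, hS₀, hmax⟩ := S.exists_max_image (fun e => e.1) hS
  obtain ⟨hE₀, h3, h4⟩ := Finset.mem_filter.1 hS₀
  simp only at h3 h4
  have hb := h.bounds _ _ _ hE₀
  have hle : (⟨x₀, by omega⟩ : Fin n) ≤ ⟨y₀, by omega⟩ := by simpa using hb.2.1
  have hB₀ : ({⟨x₀, by omega⟩, ⟨y₀, by omega⟩} : Finset (Fin n)) ∈ blocksOf n E :=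
    mem_blocksOf.2 ⟨_, _, l₀, hle, hE₀, rfl⟩
  have hinner : ∀ x'' y'' l'', (x'', y'', l'') ∈ E → x'' < w.val → w.val < y'' →
      x'' ≤ x₀ ∧ y₀ ≤ y'' := by
    intro x'' y'' l'' hE'' h5 h6
    have h7 := hmax _ (Finset.mem_filter.2 ⟨hE'', h5, h6⟩)
    have h8 := h.noncrossing _ _ _ _ _ _ hE'' hE₀
    have h9 := h.unique _ _ _ _ _ _ hE'' hE₀
    simp only at h7
    refine ⟨h7, ?_⟩
    by_contra hlt
    have : x'' = x₀ ∧ y'' = y₀ ∧ l'' = l₀ := h9 (by omega)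
    omega
  refine ⟨⟨_, hB₀⟩, ?_, ?_, ?_, ?_⟩
  · rw [card_pair_eq_two]
    simp; omega
  · rw [strictEnc_pair hle]
    exact ⟨h3, h4⟩
  · rintro ⟨B, hB'⟩ - hs
    obtain ⟨x, y, hxy', rfl⟩ := hA.exists_pair hB'
    rw [strictEnc_pair hxy'] at hs
    rw [nestedLE_pair hxy' hle]
    exact hinner _ _ _ (mem_of_blockLabel h hxy' hB') hs.1 hs.2
  · have hm := mem_of_blockLabel h hle hB₀
    have h5 := hinner _ _ _ hE' h1 h2
    have h6 := h.mono _ _ _ _ _ _ hE' hm h5.1 h5.2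
    have h7 := h.mono _ _ _ _ _ _ hm hE h3.le h4.le
    exact Fin.ext (le_antisymm h6 h7)

theorem bWM_eq_sum_arcConfigs (m n : ℕ) (lam : ℝ) :
    bWM m n lam = ∑ E ∈ arcConfigs m 0 n 0 false, arcWeight lam E := by
  classical
  have h1 : bWM m n lam = ∑ P ∈ (Finset.univ : Finset (Finset (Finset (Fin n)))).sigma
      (fun π => (Finset.univ : Finset ({B // B ∈ π} → Fin m))) with
        IsANCPart P.1 ∧ WMLabel P.1 P.2,
        lam ^ (P.1.filter fun B => B.card = 1).card := by
    rw [Finset.sum_filter, Finset.sum_sigma, bWM]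
    refine Finset.sum_congr rfl fun π _ => ?_
    split_ifs with h
    · refine Finset.sum_congr rfl fun L _ => ?_
      simp [h]
    · simp [h]
  rw [h1]
  refine Finset.sum_bij (fun P _ => arcsOf P.1 P.2) ?_ ?_ ?_ ?_
  · intro P hP
    simp only [Finset.mem_filter] at hP
    exact mem_arcConfigs.2 (arcConfig_arcsOf hP.2.1 hP.2.2)
  · rintro ⟨π, L⟩ hP ⟨π', L'⟩ hP' he
    simp only [Finset.mem_filter] at hP hP'
    have h2 := fun B (hB : B ∈ π) => subset_of_arcsOf_eq hP.2.1 he hB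
    have h3 := fun B (hB : B ∈ π') => subset_of_arcsOf_eq hP'.2.1 he.symm hB
    obtain rfl : π = π' := by
      ext B
      exact ⟨fun hB => (h2 B hB).1, fun hB => (h3 B hB).1⟩
    congr 1
    funext B
    exact (h2 B.1 B.2).2
  · intro E hE
    have hE := mem_arcConfigs.1 hE
    refine ⟨⟨blocksOf n E, blockLabel hE⟩, ?_, arcsOf_blockLabel hE⟩
    simp only [Finset.mem_filter]
    exact ⟨by simp, isANCPart_blocksOf hE, wmLabel_blockLabel hE⟩
  · intro P hP
    simp only [Finset.mem_filter] at hP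
    exact (arcWeight_arcsOf lam hP.2.1).symm

end Translation

theorem bWM_eq_arcCount {m : ℕ} (hm : 0 < m) (n : ℕ) (lam : ℝ) :
    bWM m n lam = arcCount lam false n m := by
  have := sum_arcConfigs (m := m) lam n 0 0 false hm
  rw [bWM_eq_sum_arcConfigs]
  simpa using this

end ArcConfigurations

section Asymptotics

open Polynomial

/-- The primitive of `limitCount lam true n`, which governs the scaling limit of the sum of
`arcCount (lam * √m) true n i` over `i ≤ j`. -/
noncomputable def limitPrimitive (lam : ℝ) : ℕ → ℝ[X]
  | 0 => X
  | n + 1 => C lam * limitPrimitive lam n +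
      C (1 / 2) * ∑ k : Fin n, limitPrimitive lam k * limitPrimitive lam (n - 1 - k)
termination_by n => n
decreasing_by all_goals omega

/-- The scaling limit of `arcCount (lam * √m) s n j` as a polynomial in `j / m`. -/
noncomputable def limitCount (lam : ℝ) : Bool → ℕ → ℝ[X]
  | _, 0 => 1
  | s, n + 1 => (if s then C lam * limitCount lam s n else 0) +
      ∑ k : Fin n, limitPrimitive lam k * limitCount lam s (n - 1 - k)
termination_by _ n => n
decreasing_by all_goals omega

lemma limitCount_true_eq_derivative (lam : ℝ) (n : ℕ) :
    limitCount lam true n = derivative (limitPrimitive lam n) := by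
  induction n using Nat.strong_induction_on with
  | _ n ih =>
    rcases n with _ | n
    · rw [limitCount, limitPrimitive, derivative_X]
    · rw [limitCount, limitPrimitive]
      have h1 : ∀ k : Fin n, limitPrimitive lam k * limitCount lam true (n - 1 - k) =
          limitPrimitive lam k * derivative (limitPrimitive lam (n - 1 - k)) := fun k => by
        rw [ih _ (by omega)]
      have h2 : ∑ k : Fin n, derivative (limitPrimitive lam k) * limitPrimitive lam (n - 1 - k) =
          ∑ k : Fin n, limitPrimitive lam k * derivative (limitPrimitive lam (n - 1 - k)) := by
        rw [← Finset.sum_range fun k =>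
            derivative (limitPrimitive lam k) * limitPrimitive lam (n - 1 - k),
          ← Finset.sum_range fun k =>
            limitPrimitive lam k * derivative (limitPrimitive lam (n - 1 - k)),
          ← Finset.sum_range_reflect]
        refine Finset.sum_congr rfl fun k hk => ?_
        rw [Finset.mem_range] at hk
        rw [show n - 1 - (n - 1 - k) = k by omega, mul_comm]
      simp only [if_true, derivative_add, derivative_mul, derivative_C, zero_mul, zero_add,
        derivative_sum]
      rw [Finset.sum_add_distrib, h2, ih n (by omega), Finset.sum_congr rfl fun k _ => h1 k,
        ← two_mul, ← mul_assoc]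
      congr 1
      rw [show (C (1 / 2) * 2 : ℝ[X]) = 1 by
        rw [← map_ofNat C 2, ← C_mul]; norm_num, one_mul]

lemma eval_zero_limitPrimitive (lam : ℝ) (n : ℕ) : (limitPrimitive lam n).eval 0 = 0 := by
  induction n using Nat.strong_induction_on with
  | _ n ih =>
    rcases n with _ | n
    · rw [limitPrimitive, eval_X]
    · rw [limitPrimitive]
      simp only [eval_add, eval_mul, eval_C, eval_finsetSum]
      rw [ih n (by omega), Finset.sum_eq_zero fun k _ => by rw [ih k (by omega), zero_mul]]
      simp

lemma Polynomial.exists_abs_eval_le (p : ℝ[X]) (r : ℝ) :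
    ∃ M, ∀ x, 0 ≤ x → x ≤ r → |p.eval x| ≤ M := by
  obtain ⟨M, hM⟩ := (isCompact_Icc (a := (0 : ℝ)) (b := r)).exists_bound_of_continuousOn
    p.continuous.continuousOn
  exact ⟨M, fun x h0 h1 => hM x ⟨h0, h1⟩⟩

lemma Polynomial.exists_abs_taylor_le (p : ℝ[X]) : ∃ M, ∀ x h, 0 ≤ x → x ≤ 1 → 0 ≤ h → h ≤ 1 →
    |p.eval (x + h) - p.eval x - h * (derivative p).eval (x + h)| ≤ M * h ^ 2 := by
  induction p using Polynomial.induction_on with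
  | C a => exact ⟨0, fun x h _ _ _ _ => by simp⟩
  | add p q hp hq =>
    obtain ⟨M, hM⟩ := hp
    obtain ⟨M', hM'⟩ := hq
    refine ⟨M + M', fun x h h0 h1 h2 h3 => ?_⟩
    have := hM x h h0 h1 h2 h3
    have := hM' x h h0 h1 h2 h3
    simp only [eval_add, derivative_add]
    rw [abs_le] at *
    constructor <;> linarith
  | monomial n a ih =>
    obtain ⟨M, hM⟩ := ih
    obtain ⟨M', hM'⟩ := (derivative (C a * X ^ n)).exists_abs_eval_le 2
    refine ⟨M + M', fun x h h0 h1 h2 h3 => ?_⟩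
    rw [pow_succ, ← mul_assoc]
    set q := C a * X ^ n with hq
    have h4 := hM x h h0 h1 h2 h3
    have h5 := hM' (x + h) (by linarith) (by linarith)
    have h6 : (q * X).eval (x + h) - (q * X).eval x - h * (derivative (q * X)).eval (x + h) =
        x * (q.eval (x + h) - q.eval x - h * (derivative q).eval (x + h)) -
          h ^ 2 * (derivative q).eval (x + h) := by
      simp only [derivative_mul, derivative_X, eval_add, eval_mul, eval_X, eval_one]
      ring
    rw [h6]
    refine (abs_sub _ _).trans ?_
    rw [abs_mul, abs_mul, abs_of_nonneg h0, abs_of_nonneg (sq_nonneg h)]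
    have h7 : x * |q.eval (x + h) - q.eval x - h * (derivative q).eval (x + h)| ≤ M * h ^ 2 :=
      (mul_le_of_le_one_left (abs_nonneg _) h1).trans h4
    nlinarith [mul_le_mul_of_nonneg_left h5 (sq_nonneg h)]

/-- `u m j` is approximated by `p (j / m)` with error `O(1 / m)`, uniformly for `j ≤ m`. -/
def PolyApprox (u : ℕ → ℕ → ℝ) (p : ℝ[X]) : Prop :=
  ∃ M, ∀ m j : ℕ, 0 < m → j ≤ m → |u m j - p.eval ((j : ℝ) / m)| ≤ M / m

namespace PolyApprox

variable {u v : ℕ → ℕ → ℝ} {p q : ℝ[X]}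

lemma congr (h : PolyApprox u p) (huv : ∀ m j, 0 < m → v m j = u m j) : PolyApprox v p := by
  obtain ⟨M, hM⟩ := h
  exact ⟨M, fun m j hm hj => by rw [huv m j hm]; exact hM m j hm hj⟩

lemma const (a : ℝ) : PolyApprox (fun _ _ => a) (C a) :=
  ⟨0, fun m j _ _ => by simp⟩

lemma add (hu : PolyApprox u p) (hv : PolyApprox v q) :
    PolyApprox (fun m j => u m j + v m j) (p + q) := by
  obtain ⟨M, hM⟩ := hu
  obtain ⟨M', hM'⟩ := hv
  refine ⟨M + M', fun m j hm hj => ?_⟩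
  rw [eval_add, add_sub_add_comm, add_div]
  exact (abs_add_le _ _).trans (add_le_add (hM m j hm hj) (hM' m j hm hj))

lemma mul (hu : PolyApprox u p) (hv : PolyApprox v q) :
    PolyApprox (fun m j => u m j * v m j) (p * q) := by
  obtain ⟨M, hM⟩ := hu
  obtain ⟨M', hM'⟩ := hv
  obtain ⟨K, hK⟩ := p.exists_abs_eval_le 1
  obtain ⟨K', hK'⟩ := q.exists_abs_eval_le 1
  refine ⟨M * (M' + K') + K * M', fun m j hm hj => ?_⟩
  have hm0 : (0 : ℝ) < m := by exact_mod_cast hm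
  have hm1 : (1 : ℝ) ≤ m := by exact_mod_cast hm
  have hx0 : (0 : ℝ) ≤ (j : ℝ) / m := by positivity
  have hx1 : (j : ℝ) / m ≤ 1 := by
    rw [div_le_one hm0]
    exact_mod_cast hj
  have h1 := hM m j hm hj
  have h2 := hM' m j hm hj
  have h3 := hK _ hx0 hx1
  have h4 := hK' _ hx0 hx1
  have hM'0 : 0 ≤ M' := by
    simpa using (abs_nonneg _).trans (hM' 1 0 one_pos (by simp))
  have h5 : |v m j| ≤ M' + K' := by
    have : |v m j| ≤ |v m j - q.eval ((j : ℝ) / m)| + |q.eval ((j : ℝ) / m)| := by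
      simpa using abs_add_le (v m j - q.eval ((j : ℝ) / m)) (q.eval ((j : ℝ) / m))
    have : M' / m ≤ M' := div_le_self hM'0 hm1
    linarith
  rw [eval_mul, show u m j * v m j - p.eval ((j : ℝ) / m) * q.eval ((j : ℝ) / m) =
    (u m j - p.eval ((j : ℝ) / m)) * v m j +
      p.eval ((j : ℝ) / m) * (v m j - q.eval ((j : ℝ) / m)) by ring]
  refine (abs_add_le _ _).trans ?_
  rw [abs_mul, abs_mul, add_div, mul_div_right_comm, mul_div_assoc]
  gcongr
  · exact (abs_nonneg _).trans h1
  · exact (abs_nonneg _).trans h3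

lemma sum {n : ℕ} {u : Fin n → ℕ → ℕ → ℝ} {p : Fin n → ℝ[X]} (h : ∀ k, PolyApprox (u k) (p k)) :
    PolyApprox (fun m j => ∑ k, u k m j) (∑ k, p k) := by
  choose M hM using h
  refine ⟨∑ k, M k, fun m j hm hj => ?_⟩
  rw [eval_finsetSum, ← Finset.sum_sub_distrib, Finset.sum_div]
  exact (Finset.abs_sum_le_sum_abs _ _).trans (Finset.sum_le_sum fun k _ => hM k m j hm hj)

lemma average (h : PolyApprox u (derivative p)) (hp : p.eval 0 = 0) :
    PolyApprox (fun m j => 1 / m * ∑ i ∈ Finset.Icc 1 j, u m i) p := by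
  obtain ⟨M, hM⟩ := h
  obtain ⟨K, hK⟩ := p.exists_abs_taylor_le
  refine ⟨M + K, fun m j hm => ?_⟩
  have hm0 : (0 : ℝ) < m := by exact_mod_cast hm
  have hm1 : (1 : ℝ) ≤ m := by exact_mod_cast hm
  have key : j ≤ m → |1 / m * ∑ i ∈ Finset.Icc 1 j, u m i - p.eval ((j : ℝ) / m)| ≤
      j * ((M + K) * (1 / m) ^ 2) := by
    induction j with
    | zero => simp [hp]
    | succ j ih =>
      intro hj
      have h1 := ih (by omega)
      have h2 := hM m (j + 1) hm hj
      have h3 := hK ((j : ℝ) / m) (1 / m) (by positivity)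
        (by rw [div_le_one hm0]; exact_mod_cast (by omega : j ≤ m)) (by positivity)
        (by rw [div_le_one hm0]; exact hm1)
      rw [← add_div] at h3
      rw [Finset.sum_Icc_succ_top (by omega)]
      push_cast at h2 ⊢
      have h4 : |1 / m * (u m (j + 1) - (derivative p).eval (((j : ℝ) + 1) / m))| ≤
          M * (1 / m) ^ 2 := by
        rw [abs_mul, abs_of_pos (by positivity : (0 : ℝ) < 1 / m)]
        calc _ ≤ 1 / (m : ℝ) * (M / m) := by gcongr
          _ = _ := by ring
      rw [abs_le] at *
      constructor <;> linarith
  intro hj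
  have hMK : 0 ≤ M + K := by
    have h2 := (abs_nonneg _).trans (hM 1 0 one_pos (by simp))
    have h3 := (abs_nonneg _).trans (hK 0 1 le_rfl zero_le_one zero_le_one le_rfl)
    simp at h2 h3
    linarith
  refine (key hj).trans ?_
  have hj' : (j : ℝ) ≤ m := by exact_mod_cast hj
  calc (j : ℝ) * ((M + K) * (1 / m) ^ 2) ≤ m * ((M + K) * (1 / m) ^ 2) := by gcongr
    _ = (M + K) / m := by field_simp

end PolyApprox

lemma polyApprox_arcCount (lam : ℝ) (n : ℕ) : ∀ s,
    PolyApprox (fun m j => arcCount (lam * √m) s n j / √m ^ n) (limitCount lam s n) := by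
  induction n using Nat.strong_induction_on with
  | _ n ih =>
    intro s
    rcases n with _ | n
    · rw [limitCount]
      simpa [arcCount] using PolyApprox.const 1
    · rw [limitCount]
      have h1 : PolyApprox
          (fun m j => if s then lam * (arcCount (lam * √m) s n j / √m ^ n) else 0)
          (if s then C lam * limitCount lam s n else 0) := by
        split_ifs
        · exact (PolyApprox.const lam).mul (ih n (by omega) s)
        · simpa using PolyApprox.const 0
      have h2 := PolyApprox.sum fun k : Fin n =>
        (((limitCount_true_eq_derivative lam k) ▸ ih k (by omega) true).average
          (eval_zero_limitPrimitive lam k)).mul (ih (n - 1 - k) (by omega) s)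
      refine (h1.add h2).congr fun m j hm => ?_
      have hm0 : (0 : ℝ) < m := by exact_mod_cast hm
      have hs : 0 < √(m : ℝ) := Real.sqrt_pos.2 hm0
      rw [arcCount, add_div, Finset.sum_div]
      congr 1
      · split_ifs
        · rw [pow_succ]
          field_simp
        · simp
      · refine Finset.sum_congr rfl fun k _ => ?_
        rw [← Finset.sum_div]
        have h3 : √(m : ℝ) ^ (n + 1) = m * √(m : ℝ) ^ (k : ℕ) * √(m : ℝ) ^ (n - 1 - k) := by
          nth_rw 2 [← Real.sq_sqrt hm0.le]
          rw [← pow_add, ← pow_add]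
          congr 1
          omega
        rw [h3]
        field_simp

theorem tendsto_bWM (lam : ℝ) (n : ℕ) :
    Filter.Tendsto (fun m : ℕ => (m : ℝ) ^ (-(n : ℝ) / 2) * bWM m n (lam * √m)) Filter.atTop
      (nhds ((limitCount lam false n).eval 1)) := by
  obtain ⟨M, hM⟩ := polyApprox_arcCount lam n false
  rw [tendsto_iff_norm_sub_tendsto_zero]
  refine squeeze_zero' (Filter.Eventually.of_forall fun m => norm_nonneg _) ?_
    (tendsto_const_div_atTop_nhds_zero_nat M)
  filter_upwards [Filter.eventually_gt_atTop 0] with m hm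
  have hm0 : (0 : ℝ) < m := by exact_mod_cast hm
  have h := hM m m hm le_rfl
  rw [div_self hm0.ne'] at h
  have h1 : (m : ℝ) ^ (-(n : ℝ) / 2) = (√(m : ℝ) ^ n)⁻¹ := by
    rw [Real.sqrt_eq_rpow, ← Real.rpow_natCast, ← Real.rpow_mul hm0.le, ← Real.rpow_neg hm0.le]
    congr 1
    ring
  rw [bWM_eq_arcCount hm, h1, ← div_eq_inv_mul]
  exact h

end Asymptotics

section GeneratingFunctions

open PowerSeries

lemma coeff_X_sq_mul_mul_succ (f g : ℕ → ℝ) (n : ℕ) :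
    coeff (n + 1) (X ^ 2 * (mk f * mk g)) = ∑ k : Fin n, f k * g (n - 1 - k) := by
  rcases n with _ | n
  · simp [coeff_X_pow_mul']
  · rw [show n + 1 + 1 = n + 2 by rfl, coeff_X_pow_mul, coeff_mul,
      Finset.Nat.sum_antidiagonal_eq_sum_range_succ_mk, ← Finset.sum_range fun k =>
        f k * g (n + 1 - 1 - k)]
    simp

variable {lam : ℝ} {t : ℕ → ℝ}

lemma mk_eq_of_quadratic_recurrence (h0 : t 0 = 1)
    (hs : ∀ n, t (n + 1) = lam * t n + 1 / 2 * ∑ k : Fin n, t k * t (n - 1 - k)) :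
    mk t = 1 + C lam * (X * mk t) + C (1 / 2) * (X ^ 2 * (mk t * mk t)) := by
  ext n
  rcases n with _ | n
  · simp [h0]
  · rw [map_add, map_add, coeff_C_mul, coeff_C_mul, coeff_X_sq_mul_mul_succ, coeff_succ_X_mul,
      coeff_mk, coeff_mk, coeff_one, if_neg (by omega), hs, zero_add]

lemma C_half_mul_two : (C (1 / 2) * 2 : PowerSeries ℝ) = 1 := by
  rw [← map_ofNat (C (R := ℝ)) 2, ← map_mul]
  norm_num

lemma linear_recurrence_of_quadratic_recurrence (h0 : t 0 = 1)
    (hs : ∀ n, t (n + 1) = lam * t n + 1 / 2 * ∑ k : Fin n, t k * t (n - 1 - k)) (n : ℕ) :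
    (n + 4) * t (n + 2) = (2 * n + 5) * lam * t (n + 1) + (2 - lam ^ 2) * (n + 1) * t n := by
  have hq := mk_eq_of_quadratic_recurrence h0 hs
  have hd := congrArg (d⁄dX ℝ) hq
  simp only [map_add, Derivation.leibniz, smul_eq_mul, derivative_C, derivative_X,
    Derivation.leibniz_pow, Derivation.map_one_eq_zero, mul_zero, add_zero, zero_add, mul_one,
    nsmul_eq_mul, pow_one, Nat.cast_ofNat, Nat.add_one_sub_one] at hd
  have h2 := C_half_mul_two
  have h3 : X * d⁄dX ℝ (mk t) + C (-2 * lam) * (X * (X * d⁄dX ℝ (mk t))) +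
      C (lam ^ 2 - 2) * (X * (X * (X * d⁄dX ℝ (mk t)))) + C 2 * mk t =
      C 2 + C (3 * lam) * (X * mk t) + C (2 - lam ^ 2) * (X * (X * mk t)) := by
    simp only [map_mul, map_sub, map_pow, map_neg, map_ofNat]
    generalize mk t = T at *
    generalize d⁄dX ℝ T = T' at *
    generalize (C lam : PowerSeries ℝ) = c at *
    generalize (C (1 / 2) : PowerSeries ℝ) = e at *
    have q : 2 * T = 2 + 2 * c * X * T + X ^ 2 * T ^ 2 := by
      linear_combination 2 * hq + X ^ 2 * T ^ 2 * h2
    have d : T' * (1 - c * X - X ^ 2 * T) = c * T + X * T ^ 2 := by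
      linear_combination hd + (X ^ 2 * T * T' + X * T ^ 2) * h2
    linear_combination X * (1 - c * X - X ^ 2 * T) * d + (X ^ 3 * T' + 1 + X ^ 2 * T) * q
  have h4 := congrArg (coeff (n + 2)) h3
  simp only [map_add, coeff_C_mul] at h4
  rcases n with _ | n
  · simp [coeff_succ_X_mul, coeff_derivative] at h4 ⊢
    linear_combination h4
  · simp [coeff_succ_X_mul, coeff_derivative] at h4 ⊢
    linear_combination h4

lemma eq_of_linear_recurrence {u : ℕ → ℝ} (h0 : t 0 = 1)
    (hs : ∀ n, t (n + 1) = lam * t n + 1 / 2 * ∑ k : Fin n, t k * t (n - 1 - k))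
    (u0 : u 0 = 1) (u1 : u 1 = lam)
    (hu : ∀ n : ℕ, (n + 4) * u (n + 2) =
      (2 * n + 5) * lam * u (n + 1) + (2 - lam ^ 2) * (n + 1) * u n) : t = u := by
  funext n
  induction n using Nat.twoStepInduction with
  | zero => rw [h0, u0]
  | one => simp [hs 0, h0, u1]
  | more n h1 h2 =>
    have h3 := linear_recurrence_of_quadratic_recurrence h0 hs n
    rw [h1, h2, ← hu n] at h3
    exact mul_left_cancel₀ (by positivity) h3

lemma eq_of_moment_recurrence {u v : ℕ → ℝ} (h0 : t 0 = 1)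
    (hs : ∀ n, t (n + 1) = lam * t n + 1 / 2 * ∑ k : Fin n, t k * t (n - 1 - k))
    (u0 : u 0 = 1) (hu : ∀ n, u (n + 1) = ∑ k : Fin n, t k * u (n - 1 - k))
    (v0 : v 0 = 1) (v1 : v 1 = 0) (hv : ∀ n, t n = 2 * v n + 2 * lam * v (n + 1) - v (n + 2)) :
    u = v := by
  have hq := mk_eq_of_quadratic_recurrence h0 hs
  have h2 := C_half_mul_two
  have hU : mk u = 1 + X ^ 2 * (mk t * mk u) := by
    ext n
    rcases n with _ | n
    · simp [u0]
    · rw [map_add, coeff_X_sq_mul_mul_succ, coeff_mk, coeff_one, if_neg (by omega), hu, zero_add]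
  have hV : (1 - C (2 * lam) * X - 2 * X ^ 2) * mk v = 1 - C (2 * lam) * X - X ^ 2 * mk t := by
    have : mk v = C (2 * lam) * (X * mk v) + C 2 * (X * (X * mk v)) + 1 - C (2 * lam) * X -
        X * (X * mk t) := by
      ext n
      simp only [map_add, map_sub, coeff_C_mul]
      rcases n with _ | _ | n
      · simp [v0]
      · simp [coeff_succ_X_mul, v0, v1, coeff_one]
      · simp [coeff_succ_X_mul, coeff_X, coeff_one, hv]
        ring
    rw [map_ofNat] at this
    linear_combination this
  have hV' : mk v * (1 - X ^ 2 * mk t) = 1 := by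
    have hQ : (1 - C (2 * lam) * X - 2 * X ^ 2 : PowerSeries ℝ) ≠ 0 := by
      intro h
      simpa using congrArg (coeff 0) h
    apply mul_left_cancel₀ hQ
    rw [map_mul, map_ofNat] at *
    generalize (C (1 / 2) : PowerSeries ℝ) = e at *
    have q : 2 * mk t = 2 + 2 * C lam * X * mk t + X ^ 2 * mk t ^ 2 := by
      linear_combination 2 * hq + X ^ 2 * mk t ^ 2 * h2
    linear_combination (1 - X ^ 2 * mk t) * hV - X ^ 2 * q
  have : mk u = mk v := by linear_combination mk v * hU - mk u * hV'
  funext n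
  simpa using congrArg (coeff n) this

end GeneratingFunctions

section Moments

open Real intervalIntegral

variable {lam y : ℝ}

lemma sq_le_two_of_mem_Icc (hy : y ∈ Set.Icc (-√2) √2) : y ^ 2 ≤ 2 :=
  (sq_le_sq' hy.1 hy.2).trans_eq (sq_sqrt zero_le_two)

lemma sq_lt_two_of_mem_Ioo (hy : y ∈ Set.Ioo (-√2) √2) : y ^ 2 < 2 :=
  (sq_lt_sq' hy.1 hy.2).trans_eq (sq_sqrt zero_le_two)

lemma neg_sqrt_two_le_sqrt_two : -√2 ≤ √2 := by
  linarith [sqrt_nonneg 2]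

/-- The density of `nuAC lam`, recentred at the origin. -/
noncomputable def acDensity (lam y : ℝ) : ℝ := √(2 - y ^ 2) / (π * (lam ^ 2 + 2 - y ^ 2))

lemma acDensity_denom_pos (hlam : 0 < lam) (hy : y ∈ Set.Icc (-√2) √2) :
    0 < lam ^ 2 + 2 - y ^ 2 := by
  have := sq_le_two_of_mem_Icc hy
  have : 0 < lam ^ 2 := by positivity
  linarith

lemma continuousOn_acDensity (hlam : 0 < lam) :
    ContinuousOn (acDensity lam) (Set.Icc (-√2) √2) := by
  unfold acDensity
  refine ContinuousOn.div (by fun_prop) (by fun_prop) fun y hy => ?_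
  have := acDensity_denom_pos hlam hy
  positivity

lemma intervalIntegrable_pow_mul_acDensity (hlam : 0 < lam) (n : ℕ) :
    IntervalIntegrable (fun y => (y + lam) ^ n * acDensity lam y) volume (-√2) √2 := by
  refine ContinuousOn.intervalIntegrable ?_
  rw [Set.uIcc_of_le neg_sqrt_two_le_sqrt_two]
  exact ContinuousOn.mul (by fun_prop) (continuousOn_acDensity hlam)

lemma nuAC_eq_withDensity (lam : ℝ) :
    nuAC lam = (volume.restrict (Set.Ioo (lam - √2) (lam + √2))).withDensity
      fun x => ENNReal.ofReal (acDensity lam (x - lam)) := by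
  rw [nuAC, ← withDensity_indicator measurableSet_Ioo]
  congr 1
  funext x
  by_cases hx : x ∈ Set.Ioo (lam - √2) (lam + √2)
  · simp only [hx, if_true, Set.indicator_of_mem, acDensity]
  · simp only [hx, if_false, not_false_eq_true, Set.indicator_of_notMem, ENNReal.ofReal_zero]

lemma measurable_ofReal_acDensity_sub (lam : ℝ) :
    Measurable fun x => ENNReal.ofReal (acDensity lam (x - lam)) := by
  unfold acDensity
  fun_prop

lemma setIntegrand_eq (hlam : 0 < lam) (n : ℕ) :
    Set.EqOn (fun x => (ENNReal.ofReal (acDensity lam (x - lam))).toReal • x ^ n)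
      (fun x => (x - lam + lam) ^ n * acDensity lam (x - lam))
      (Set.Ioo (lam - √2) (lam + √2)) := by
  intro x hx
  have hy : x - lam ∈ Set.Icc (-√2) √2 := ⟨by linarith [hx.1], by linarith [hx.2]⟩
  have := acDensity_denom_pos hlam hy
  have h0 : 0 ≤ acDensity lam (x - lam) := by
    unfold acDensity
    positivity
  simp only [ENNReal.toReal_ofReal h0, smul_eq_mul, sub_add_cancel, mul_comm]

lemma integrable_pow_nuAC (hlam : 0 < lam) (n : ℕ) :
    Integrable (fun x => x ^ n) (nuAC lam) := by
  rw [nuAC_eq_withDensity, integrable_withDensity_iff_integrable_smul'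
    (measurable_ofReal_acDensity_sub lam) (by simp)]
  have h := (intervalIntegrable_pow_mul_acDensity hlam n).comp_sub_right lam
  rw [intervalIntegrable_iff_integrableOn_Ioo_of_le (by linarith [sqrt_nonneg 2]),
    neg_add_eq_sub, add_comm] at h
  exact h.congr_fun (setIntegrand_eq hlam n).symm measurableSet_Ioo

lemma integral_pow_nuAC (hlam : 0 < lam) (n : ℕ) :
    ∫ x, x ^ n ∂nuAC lam = ∫ y in (-√2)..√2, (y + lam) ^ n * acDensity lam y := by
  rw [nuAC_eq_withDensity, integral_withDensity_eq_integral_toReal_smul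
    (measurable_ofReal_acDensity_sub lam) (by simp),
    setIntegral_congr_fun measurableSet_Ioo (setIntegrand_eq hlam n),
    ← integral_Ioc_eq_integral_Ioo,
    ← intervalIntegral.integral_of_le (by linarith [sqrt_nonneg 2]),
    intervalIntegral.integral_comp_sub_right fun y => (y + lam) ^ n * acDensity lam y]
  simp

lemma integral_pow_nuMeas (hlam : 0 < lam) (n : ℕ) :
    ∫ x, x ^ n ∂nuMeas lam = lam / √(lam ^ 2 + 2) * (lam - √(lam ^ 2 + 2)) ^ n +
      ∫ y in (-√2)..√2, (y + lam) ^ n * acDensity lam y := by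
  rw [nuMeas, integral_add_measure _ (integrable_pow_nuAC hlam n), integral_pow_nuAC hlam,
    MeasureTheory.integral_smul_measure, integral_dirac, ENNReal.toReal_ofReal (by positivity), smul_eq_mul]
  exact (integrable_dirac (by simp)).smul_measure (by simp)

/-- A primitive of `acDensity lam`. -/
noncomputable def acPrimitive (lam y : ℝ) : ℝ :=
  1 / π * (arcsin (y / √2) -
    lam / √(lam ^ 2 + 2) * arcsin (lam * y / (√2 * √(lam ^ 2 + 2 - y ^ 2))))

lemma hasDerivAt_acPrimitive (hlam : 0 < lam) (hy : y ∈ Set.Ioo (-√2) √2) :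
    HasDerivAt (acPrimitive lam) (acDensity lam y) y := by
  have hy2 := sq_lt_two_of_mem_Ioo hy
  have hd := acDensity_denom_pos hlam (Set.Ioo_subset_Icc_self hy)
  unfold acDensity
  have hw : 0 < √(2 - y ^ 2) := sqrt_pos.2 (by linarith)
  have hw2 : √(2 - y ^ 2) ^ 2 = 2 - y ^ 2 := sq_sqrt (by linarith)
  have hq : 0 < √(lam ^ 2 + 2 - y ^ 2) := sqrt_pos.2 hd
  have hq2 : √(lam ^ 2 + 2 - y ^ 2) ^ 2 = lam ^ 2 + 2 - y ^ 2 := sq_sqrt hd.le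
  have hc : 0 < √(lam ^ 2 + 2) := by positivity
  have hc2 : √(lam ^ 2 + 2) ^ 2 = lam ^ 2 + 2 := sq_sqrt (by positivity)
  have hs : 0 < √2 := by positivity
  have hs2 : √2 ^ 2 = 2 := sq_sqrt zero_le_two
  have hqd : HasDerivAt (fun y => √(lam ^ 2 + 2 - y ^ 2))
      (-(2 * y) / (2 * √(lam ^ 2 + 2 - y ^ 2))) y := by
    refine HasDerivAt.sqrt ?_ hd.ne'
    simpa using (hasDerivAt_pow 2 y).const_sub (lam ^ 2 + 2)
  have hv := ((hasDerivAt_id y).const_mul lam).div (hqd.const_mul √2) (by positivity)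
  simp only [id] at hv
  set w := √(2 - y ^ 2)
  have e1 : 1 - (y / √2) ^ 2 = (w / √2) ^ 2 := by
    rw [div_pow, div_pow, hs2, hw2]
    ring
  have ne_of {x : ℝ} {z : ℝ} (hz : 0 < z) (h : 1 - x ^ 2 = z ^ 2) : x ≠ -1 ∧ x ≠ 1 := by
    constructor <;> rintro rfl <;> nlinarith
  have h1 := ne_of (by positivity) e1
  have e2 : 1 - (lam * y / (√2 * √(lam ^ 2 + 2 - y ^ 2))) ^ 2 =
      (√(lam ^ 2 + 2) * w / (√2 * √(lam ^ 2 + 2 - y ^ 2))) ^ 2 := by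
    simp only [div_pow, mul_pow, hs2, hq2, hc2, hw2]
    field_simp
    ring
  have h2 := ne_of (by positivity) e2
  have A := (hasDerivAt_arcsin h1.1 h1.2).comp y ((hasDerivAt_id y).div_const √2)
  have B := (hasDerivAt_arcsin h2.1 h2.2).comp y hv
  rw [e1, sqrt_sq (by positivity)] at A
  rw [e2, sqrt_sq (by positivity)] at B
  refine ((A.sub (B.const_mul (lam / √(lam ^ 2 + 2)))).const_mul (1 / π)).congr_deriv ?_
  simp only [hq2, mul_pow, hs2]
  rw [← hq2]
  generalize √(lam ^ 2 + 2 - y ^ 2) = q at *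
  generalize √(lam ^ 2 + 2) = c at *
  rw [sqrt_sq hq.le]
  field_simp
  rw [hs2, hw2, sub_neg_eq_add, hq2, hc2]
  ring

lemma integral_acDensity (hlam : 0 < lam) :
    ∫ y in (-√2)..√2, acDensity lam y = 1 - lam / √(lam ^ 2 + 2) := by
  have hcont : ContinuousOn (acPrimitive lam) (Set.Icc (-√2) √2) := by
    unfold acPrimitive
    have : ContinuousOn (fun y => lam * y / (√2 * √(lam ^ 2 + 2 - y ^ 2))) (Set.Icc (-√2) √2) := by
      refine ContinuousOn.div (by fun_prop) (by fun_prop) fun y hy => ?_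
      have := acDensity_denom_pos hlam hy
      positivity
    have := continuous_arcsin.comp_continuousOn this
    have h' : Continuous fun y => arcsin (y / √2) := continuous_arcsin.comp (by fun_prop)
    exact continuousOn_const.mul (h'.continuousOn.sub (continuousOn_const.mul this))
  rw [integral_eq_sub_of_hasDerivAt_of_le neg_sqrt_two_le_sqrt_two hcont
    (fun y hy => hasDerivAt_acPrimitive hlam hy) (by
      simpa using intervalIntegrable_pow_mul_acDensity hlam 0)]
  have h1 : lam * √2 / (√2 * lam) = 1 := by
    field_simp
  simp only [acPrimitive, neg_sq, sq_sqrt zero_le_two, add_sub_cancel_right, sqrt_sq hlam.le,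
    mul_neg, neg_div, arcsin_neg, h1, div_self (by positivity : √2 ≠ 0), arcsin_one]
  field_simp
  ring

lemma integral_mul_acDensity (lam : ℝ) : ∫ y in (-√2)..√2, y * acDensity lam y = 0 := by
  have h := intervalIntegral.integral_comp_neg (a := -√2) (b := √2) fun y => y * acDensity lam y
  simp only [acDensity, neg_sq, neg_mul, intervalIntegral.integral_neg, neg_neg] at h ⊢
  linarith

lemma integral_pow_zero_nuMeas (hlam : 0 < lam) : ∫ x, x ^ 0 ∂nuMeas lam = 1 := by
  rw [integral_pow_nuMeas hlam]
  simp [integral_acDensity hlam]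

lemma integral_pow_one_nuMeas (hlam : 0 < lam) : ∫ x, x ^ 1 ∂nuMeas lam = 0 := by
  have h0 : IntervalIntegrable (acDensity lam) volume (-√2) √2 := by
    simpa using intervalIntegrable_pow_mul_acDensity hlam 0
  have h1 : IntervalIntegrable (fun y => y * acDensity lam y) volume (-√2) √2 := by
    have := (intervalIntegrable_pow_mul_acDensity hlam 1).sub (h0.const_mul lam)
    refine this.congr fun y _ => ?_
    ring
  rw [integral_pow_nuMeas hlam]
  simp only [pow_one, add_mul]
  rw [intervalIntegral.integral_add h1 (h0.const_mul lam), intervalIntegral.integral_const_mul,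
    integral_mul_acDensity, integral_acDensity hlam]
  field_simp
  ring

/-- The moments of the semicircle law of variance `1 / 2` centred at `lam`. -/
noncomputable def semicircleMoment (lam : ℝ) (n : ℕ) : ℝ :=
  ∫ y in (-√2)..√2, (y + lam) ^ n * (√(2 - y ^ 2) / π)

lemma semicircleMoment_eq (hlam : 0 < lam) (n : ℕ) :
    semicircleMoment lam n = 2 * (∫ x, x ^ n ∂nuMeas lam) +
      2 * lam * (∫ x, x ^ (n + 1) ∂nuMeas lam) - ∫ x, x ^ (n + 2) ∂nuMeas lam := by
  have h (k) := intervalIntegrable_pow_mul_acDensity hlam k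
  have hc2 : √(lam ^ 2 + 2) ^ 2 = lam ^ 2 + 2 := sq_sqrt (by positivity)
  have key : semicircleMoment lam n = 2 * (∫ y in (-√2)..√2, (y + lam) ^ n * acDensity lam y) +
      2 * lam * (∫ y in (-√2)..√2, (y + lam) ^ (n + 1) * acDensity lam y) -
      ∫ y in (-√2)..√2, (y + lam) ^ (n + 2) * acDensity lam y := by
    rw [← intervalIntegral.integral_const_mul, ← intervalIntegral.integral_const_mul,
      ← intervalIntegral.integral_add ((h n).const_mul _) ((h (n + 1)).const_mul _),
      ← intervalIntegral.integral_sub (((h n).const_mul _).add ((h (n + 1)).const_mul _))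
        (h (n + 2)), semicircleMoment]
    refine intervalIntegral.integral_congr fun y hy => ?_
    rw [Set.uIcc_of_le neg_sqrt_two_le_sqrt_two] at hy
    have := acDensity_denom_pos hlam hy
    simp only [acDensity]
    field_simp
    ring
  simp only [integral_pow_nuMeas hlam]
  rw [key]
  generalize √(lam ^ 2 + 2) = c at *
  linear_combination (lam / c * (lam - c) ^ n) * hc2

lemma intervalIntegrable_pow_mul_semicircle (lam : ℝ) (n : ℕ) :
    IntervalIntegrable (fun y => (y + lam) ^ n * (√(2 - y ^ 2) / π)) volume (-√2) √2 :=
  Continuous.intervalIntegrable (by fun_prop) _ _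

lemma semicircleMoment_zero (lam : ℝ) : semicircleMoment lam 0 = 1 := by
  have h := intervalIntegral.mul_integral_comp_mul_left (a := -1) (b := 1) (c := √2)
    (f := fun y => √(2 - y ^ 2))
  have h2 (x : ℝ) : √(2 - (√2 * x) ^ 2) = √2 * √(1 - x ^ 2) := by
    rw [mul_pow, sq_sqrt zero_le_two, ← sqrt_mul zero_le_two]
    ring_nf
  simp only [h2, intervalIntegral.integral_const_mul, integral_sqrt_one_sub_sq, mul_neg,
    mul_one] at h
  simp only [semicircleMoment, pow_zero, one_mul, intervalIntegral.integral_div, ← h]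
  rw [← mul_assoc, mul_self_sqrt zero_le_two]
  field_simp

lemma semicircleMoment_one (lam : ℝ) : semicircleMoment lam 1 = lam := by
  have h := intervalIntegral.integral_comp_neg (a := -√2) (b := √2)
    fun y => y * (√(2 - y ^ 2) / π)
  simp only [neg_sq, neg_mul, intervalIntegral.integral_neg, neg_neg] at h
  have h0 := semicircleMoment_zero lam
  simp only [semicircleMoment, pow_zero, pow_one, one_mul, add_mul] at h0 ⊢
  rw [intervalIntegral.integral_add (Continuous.intervalIntegrable (by fun_prop) _ _)
    (Continuous.intervalIntegrable (by fun_prop) _ _), intervalIntegral.integral_const_mul, h0]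
  linarith

lemma semicircleMoment_recurrence (lam : ℝ) (n : ℕ) :
    (n + 4) * semicircleMoment lam (n + 2) = (2 * n + 5) * lam * semicircleMoment lam (n + 1) +
      (2 - lam ^ 2) * (n + 1) * semicircleMoment lam n := by
  have hderiv (y) (hy : y ∈ Set.Ioo (-√2) √2) : HasDerivAt
      (fun y => (y + lam) ^ (n + 1) * ((2 - y ^ 2) * (√(2 - y ^ 2) / π)))
      ((2 - lam ^ 2) * (n + 1) * ((y + lam) ^ n * (√(2 - y ^ 2) / π)) +
        (2 * n + 5) * lam * ((y + lam) ^ (n + 1) * (√(2 - y ^ 2) / π)) -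
        (n + 4) * ((y + lam) ^ (n + 2) * (√(2 - y ^ 2) / π))) y := by
    have hy2 := sq_lt_two_of_mem_Ioo hy
    have hw : 0 < √(2 - y ^ 2) := sqrt_pos.2 (by linarith)
    have hw2 : √(2 - y ^ 2) ^ 2 = 2 - y ^ 2 := sq_sqrt (by linarith)
    have h1 : HasDerivAt (fun y : ℝ => 2 - y ^ 2) (-(2 * y)) y := by
      simpa using (hasDerivAt_pow 2 y).const_sub 2
    have h2 := ((hasDerivAt_id y).add_const lam).fun_pow (n + 1)
    refine (h2.mul (h1.mul ((h1.sqrt (by linarith)).div_const π))).congr_deriv ?_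
    simp only [id, Pi.mul_apply, Nat.cast_add, Nat.cast_one, Nat.add_sub_cancel]
    generalize √(2 - y ^ 2) = w at *
    field_simp
    rw [hw2]
    ring
  have h (k) := intervalIntegrable_pow_mul_semicircle lam k
  have hF := integral_eq_sub_of_hasDerivAt_of_le neg_sqrt_two_le_sqrt_two
    (by fun_prop) hderiv (Continuous.intervalIntegrable (by fun_prop) _ _)
  rw [intervalIntegral.integral_sub (((h n).const_mul _).add ((h (n + 1)).const_mul _))
    ((h (n + 2)).const_mul _), intervalIntegral.integral_add ((h n).const_mul _)
    ((h (n + 1)).const_mul _), intervalIntegral.integral_const_mul,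
    intervalIntegral.integral_const_mul, intervalIntegral.integral_const_mul] at hF
  simp only [neg_sq, sq_sqrt zero_le_two, sub_self, zero_mul, mul_zero] at hF
  unfold semicircleMoment
  linarith

end Moments

theorem stmt13 (lam : ℝ) (hlam : 0 < lam) (n : ℕ) :
    Filter.Tendsto
      (fun m : ℕ => (m : ℝ) ^ (-(n : ℝ) / 2) * bWM m n (lam * Real.sqrt m))
      Filter.atTop (nhds (∫ x, x ^ n ∂(nuMeas lam))) := by
  have h0 : (limitPrimitive lam 0).eval 1 = 1 := by simp [limitPrimitive]
  have hs (n : ℕ) : (limitPrimitive lam (n + 1)).eval 1 = lam * (limitPrimitive lam n).eval 1 +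
      1 / 2 * ∑ k : Fin n, (limitPrimitive lam k).eval 1 *
        (limitPrimitive lam (n - 1 - k)).eval 1 := by
    rw [limitPrimitive]
    simp [Polynomial.eval_finsetSum]
  have u0 : (limitCount lam false 0).eval 1 = 1 := by simp [limitCount]
  have hu (n : ℕ) : (limitCount lam false (n + 1)).eval 1 =
      ∑ k : Fin n, (limitPrimitive lam k).eval 1 *
        (limitCount lam false (n - 1 - k)).eval 1 := by
    rw [limitCount]
    simp [Polynomial.eval_finsetSum]
  have ht := eq_of_linear_recurrence (t := fun n => (limitPrimitive lam n).eval 1) h0 hs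
    (semicircleMoment_zero lam) (semicircleMoment_one lam) (semicircleMoment_recurrence lam)
  have h := eq_of_moment_recurrence (u := fun n => (limitCount lam false n).eval 1)
    (v := fun n => ∫ x, x ^ n ∂nuMeas lam) h0 hs u0 hu (integral_pow_zero_nuMeas hlam)
    (integral_pow_one_nuMeas hlam) fun n => (congrFun ht n).trans (semicircleMoment_eq hlam n)
  rw [← congrFun h n]
  exact tendsto_bWM lam n
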